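/- arXiv:2504.10425 — 3 statements merged into one kernel-verified Lean document; each statement's English description precedes it below -/
import Mathlib

section
/- There exist absolute constants c0, c1 > 0 such that for all integers k ≥ 2 and d with d ≥ c0·log k, liminf_{n→∞} E_{k,d}(n)/n ≥ (1/k)·(1 + c1/√d). -/
/-- The length of the longest common subsequence of the `d` strings `X 0, …, X (d-1)`
over the alphabet `Fin k`. -/
noncomputable def lcsLen {k : ℕ} (d : ℕ) (X : Fin d → List (Fin k)) : ℕ :=
  sSup {m : ℕ | ∃ w : List (Fin k), w.length = m ∧ ∀ i : Fin d, w.Sublist (X i)}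

/-- `expLCS k d n` is the expected LCS length of `d` independent uniformly random strings
of length `n` over an alphabet of size `k`. -/
noncomputable def expLCS (k d n : ℕ) : ℝ :=
  (∑ X : Fin d → Fin n → Fin k, (lcsLen d (fun i => List.ofFn (X i)) : ℝ)) /
    (Fintype.card (Fin d → Fin n → Fin k) : ℝ)

open Finset Function Filter Topology
open scoped BigOperators

/-- Averaging over a component of a uniformly random point (accessed by `get` and `set`)
does not change the expectation. -/
theorem expect_eq_expect_expect_set {Ω A : Type*} [Fintype Ω] [Fintype A] [Nonempty A]
    (get : Ω → A) (set : Ω → A → Ω) (get_set : ∀ ω a, get (set ω a) = a)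
    (set_set : ∀ ω a b, set (set ω a) b = set ω b) (set_get : ∀ ω, set ω (get ω) = ω)
    (f : Ω → ℝ) : 𝔼 ω, f ω = 𝔼 a, 𝔼 ω, f (set ω a) := by
  have h1 : 𝔼 ω, f ω = 𝔼 z : Ω × A, f z.1 := by
    rw [← Finset.univ_product_univ, Finset.expect_product]
    simp [Finset.expect_const Finset.univ_nonempty]
  have h2 : 𝔼 a, 𝔼 ω, f (set ω a) = 𝔼 z : Ω × A, f (set z.1 z.2) := by
    rw [← Finset.univ_product_univ, Finset.expect_product, Finset.expect_comm]
  rw [h1, h2]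
  let φ : Ω × A → Ω × A := fun z => (set z.1 z.2, get z.1)
  have hφ : Function.Involutive φ := by
    rintro ⟨ω, a⟩
    simp [φ, get_set, set_set, set_get]
  refine Fintype.expect_equiv hφ.toPerm _ _ fun z => ?_
  simp [φ, set_set, set_get]

section Signs

/-- The sign `±1` of a bit. -/
def bitSign (b : Bool) : ℝ := if b then 1 else -1

/-- The majority bit of a tuple of bits. -/
noncomputable def majority {d : ℕ} (b : Fin d → Bool) : Bool :=
  decide (0 ≤ ∑ i, bitSign (b i))

theorem sum_cons_bool {d : ℕ} (f : (Fin (d + 1) → Bool) → ℝ) :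
    ∑ b, f b = ∑ b : Fin d → Bool, (f (Fin.cons true b) + f (Fin.cons false b)) := by
  rw [← (Fin.consEquiv fun _ : Fin (d + 1) => Bool).sum_comp, Fintype.sum_prod_type,
    Fintype.sum_bool, ← Finset.sum_add_distrib]
  rfl

theorem sum_bitSign_sq (d : ℕ) :
    ∑ b : Fin d → Bool, (∑ i, bitSign (b i)) ^ 2 = d * 2 ^ d := by
  induction d with
  | zero => simp
  | succ d ih =>
    rw [sum_cons_bool]
    have : ∀ b : Fin d → Bool, (∑ i, bitSign ((Fin.cons true b : Fin (d + 1) → Bool) i)) ^ 2 +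
        (∑ i, bitSign ((Fin.cons false b : Fin (d + 1) → Bool) i)) ^ 2 =
        2 * (∑ i, bitSign (b i)) ^ 2 + 2 := by
      intro b
      simp only [Fin.sum_univ_succ, Fin.cons_zero, Fin.cons_succ, bitSign]
      simp only [if_true, Bool.false_eq_true, if_false]
      ring
    simp only [this, Finset.sum_add_distrib, ← Finset.mul_sum, ih]
    simp
    ring

theorem sum_bitSign_pow_four (d : ℕ) :
    ∑ b : Fin d → Bool, (∑ i, bitSign (b i)) ^ 4 = (3 * d ^ 2 - 2 * d) * 2 ^ d := by
  induction d with
  | zero => simp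
  | succ d ih =>
    rw [sum_cons_bool]
    have : ∀ b : Fin d → Bool, (∑ i, bitSign ((Fin.cons true b : Fin (d + 1) → Bool) i)) ^ 4 +
        (∑ i, bitSign ((Fin.cons false b : Fin (d + 1) → Bool) i)) ^ 4 =
        2 * (∑ i, bitSign (b i)) ^ 4 + 12 * (∑ i, bitSign (b i)) ^ 2 + 2 := by
      intro b
      simp only [Fin.sum_univ_succ, Fin.cons_zero, Fin.cons_succ, bitSign]
      simp only [if_true, Bool.false_eq_true, if_false]
      ring
    simp only [this, Finset.sum_add_distrib, ← Finset.mul_sum, ih, sum_bitSign_sq]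
    simp
    ring

theorem sqrt_le_expect_abs_sum_bitSign {d : ℕ} (hd : 1 ≤ d) :
    √d / 4 ≤ 𝔼 b : Fin d → Bool, |∑ i, bitSign (b i)| := by
  have hd0 : (0 : ℝ) < d := by exact_mod_cast hd
  set r := √(d : ℝ) with hr
  have hr0 : 0 < r := Real.sqrt_pos.2 hd0
  have hrr : r ^ 2 = d := Real.sq_sqrt hd0.le
  have key : ∀ t : ℝ, 0 ≤ t → t ^ 2 - t ^ 4 / 4 ≤ t := by
    intro t ht
    have : 0 ≤ 1 - t + t ^ 3 / 4 := by
      nlinarith [mul_nonneg ht (sq_nonneg (t - 5 / 4)), sq_nonneg (t - 1), sq_nonneg (t - 5 / 4)]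
    nlinarith [mul_nonneg ht this]
  have key' : ∀ s : ℝ, s ^ 2 / r - s ^ 4 / (4 * r ^ 3) ≤ |s| := by
    intro s
    have h := mul_le_mul_of_nonneg_left (key (|s| / r) (by positivity)) hr0.le
    have e1 : |s| ^ 2 = s ^ 2 := sq_abs s
    have e2 : |s| ^ 4 = s ^ 4 := by rw [show 4 = 2 * 2 from rfl, pow_mul, e1, pow_mul]
    have e3 : r * (|s| / r) = |s| := by field_simp
    rw [e3, div_pow, div_pow, e1, e2] at h
    refine le_trans (le_of_eq ?_) h
    field_simp
  rw [Fintype.expect_eq_sum_div_card, le_div_iff₀ (by simp)]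
  refine le_trans ?_ (Finset.sum_le_sum fun b _ => key' _)
  rw [Finset.sum_sub_distrib, ← Finset.sum_div, ← Finset.sum_div, sum_bitSign_sq,
    sum_bitSign_pow_four]
  have h2 : (0 : ℝ) < 2 ^ d := by positivity
  simp only [Fintype.card_pi, Fintype.card_bool, Finset.prod_const, Finset.card_univ,
    Fintype.card_fin, Nat.cast_pow, Nat.cast_ofNat]
  rw [← hrr]
  have : r ^ 2 * 2 ^ d / r - (3 * (r ^ 2) ^ 2 - 2 * r ^ 2) * 2 ^ d / (4 * r ^ 3)
      = r / 4 * 2 ^ d + 2 ^ d / (2 * r) := by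
    field_simp
    ring
  rw [this]
  have : 0 < 2 ^ d / (2 * r) := by positivity
  linarith

theorem bitSign_majority_mul_sum {d : ℕ} (b : Fin d → Bool) :
    bitSign (majority b) * ∑ i, bitSign (b i) = |∑ i, bitSign (b i)| := by
  unfold majority
  generalize ∑ i, bitSign (b i) = s
  by_cases h : 0 ≤ s
  · simp [bitSign, h, abs_of_nonneg h]
  · simp [bitSign, h, abs_of_neg (not_le.1 h)]

/-- The correlation of one bit with the majority bit does not depend on the chosen bit. -/
theorem expect_bitSign_mul_majority_eq {d : ℕ} (i j : Fin d) :
    𝔼 b : Fin d → Bool, bitSign (b i) * bitSign (majority b) =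
      𝔼 b : Fin d → Bool, bitSign (b j) * bitSign (majority b) := by
  refine Fintype.expect_equiv (Equiv.arrowCongr (Equiv.swap i j) (Equiv.refl Bool)) _ _ fun b => ?_
  have : majority (Equiv.arrowCongr (Equiv.swap i j) (Equiv.refl Bool) b) = majority b := by
    unfold majority
    congr 2
    exact Equiv.sum_comp (Equiv.swap i j) fun l => bitSign (b l)
  rw [this]
  simp [Equiv.arrowCongr]

theorem exists_majority_correlation {d : ℕ} (hd : 1 ≤ d) :
    ∃ θ : ℝ, 1 / (4 * √d) ≤ θ ∧ θ ≤ 1 ∧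
      ∀ i, 𝔼 b : Fin d → Bool, bitSign (b i) * bitSign (majority b) = θ := by
  refine ⟨_, ?_, ?_, fun i => expect_bitSign_mul_majority_eq i ⟨0, hd⟩⟩
  · set θ := 𝔼 b : Fin d → Bool, bitSign (b ⟨0, hd⟩) * bitSign (majority b) with hθ
    have h : (d : ℝ) * θ = 𝔼 b : Fin d → Bool, |∑ i, bitSign (b i)| := by
      calc (d : ℝ) * θ
          = ∑ i : Fin d, 𝔼 b : Fin d → Bool, bitSign (b i) * bitSign (majority b) := by
            rw [Finset.sum_congr rfl fun i _ => expect_bitSign_mul_majority_eq i ⟨0, hd⟩]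
            simp [hθ]
        _ = 𝔼 b : Fin d → Bool, ∑ i, bitSign (b i) * bitSign (majority b) :=
            (Finset.expect_sum_comm ..).symm
        _ = _ := by
            refine Finset.expect_congr rfl fun b _ => ?_
            rw [← Finset.sum_mul, mul_comm, bitSign_majority_mul_sum]
    have hd0 : (0 : ℝ) < d := by exact_mod_cast hd
    have h3 := sqrt_le_expect_abs_sum_bitSign hd
    rw [← h] at h3
    have hr0 : 0 < √(d : ℝ) := Real.sqrt_pos.2 hd0
    have hrr : √(d : ℝ) * √d = d := Real.mul_self_sqrt hd0.le
    rw [div_le_iff₀ (by positivity)]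
    nlinarith
  · refine Finset.expect_le Finset.univ_nonempty fun b _ => ?_
    unfold bitSign
    split_ifs <;> norm_num

end Signs

section Strategy

variable {d N k : ℕ}

open Classical in
/-- The probability of `P` under the uniform distribution on a finite type. -/
noncomputable def unifProb {Ω : Type*} [Fintype Ω] (P : Ω → Prop) : ℝ :=
  𝔼 ω, if P ω then 1 else 0

theorem unifProb_mono {Ω : Type*} [Fintype Ω] {P Q : Ω → Prop} (h : ∀ ω, P ω → Q ω) :
    unifProb P ≤ unifProb Q := by
  unfold unifProb
  refine Finset.expect_le_expect fun ω _ => ?_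
  have := h ω
  split_ifs <;> simp_all

theorem unifProb_le_one {Ω : Type*} [Fintype Ω] (P : Ω → Prop) : unifProb P ≤ 1 := by
  unfold unifProb
  cases isEmpty_or_nonempty Ω
  · simp
  · refine Finset.expect_le Finset.univ_nonempty fun b _ => ?_
    split_ifs <;> norm_num

theorem unifProb_eq_zero {Ω : Type*} [Fintype Ω] {P : Ω → Prop} (h : ∀ ω, ¬P ω) :
    unifProb P = 0 := by
  simp [unifProb, h]

/-- Replace the symbol at position `j` of the `i`-th string by `a`. -/
def setSymbol (X : Fin d → Fin N → Fin k) (i : Fin d) (j : Fin N) (a : Fin k) :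
    Fin d → Fin N → Fin k :=
  update X i (update (X i) j a)

theorem unifProb_eq_expect_setSymbol [NeZero k] (P : (Fin d → Fin N → Fin k) → Prop)
    (i : Fin d) (j : Fin N) :
    unifProb P = 𝔼 a, unifProb fun X => P (setSymbol X i j a) :=
  expect_eq_expect_expect_set (fun X => X i j) (fun X a => setSymbol X i j a)
    (by simp [setSymbol]) (by simp [setSymbol]) (by simp [setSymbol]) _

/-- The unread part of the `i`-th string when `p i` symbols have been read. -/
def unread (X : Fin d → Fin N → Fin k) (p : Fin d → ℕ) (i : Fin d) : List (Fin k) :=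
  (List.ofFn (X i)).drop (p i)

theorem unread_setSymbol_self (X : Fin d → Fin N → Fin k) (p : Fin d → ℕ) {i : Fin d}
    (h : p i < N) (a : Fin k) :
    unread (setSymbol X i ⟨p i, h⟩ a) p i = a :: unread X (update p i (p i + 1)) i := by
  unfold unread setSymbol
  rw [List.drop_eq_getElem_cons (by simpa using h)]
  congr 1
  · simp
  · simp only [update_self]
    apply List.ext_getElem
    · simp
    · intro n h1 h2
      simp only [List.getElem_drop, List.getElem_ofFn]
      rw [update_of_ne]
      simp [Fin.ext_iff]
      omega

theorem unread_setSymbol_of_ne (X : Fin d → Fin N → Fin k) (p : Fin d → ℕ) {i j : Fin d}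
    (hj : j ≠ i) (l : Fin N) (a : Fin k) (q : ℕ) :
    unread (setSymbol X i l a) p j = unread X (update p i q) j := by
  simp [unread, setSymbol, hj]

theorem sum_sub_update_lt {p : Fin d → ℕ} {i : Fin d} (h : p i < N) :
    ∑ j, (N - update p i (p i + 1) j) < ∑ j, (N - p j) := by
  refine Finset.sum_lt_sum (fun j _ => ?_) ⟨i, Finset.mem_univ i, by simp; omega⟩
  by_cases hj : j = i
  · subst hj; simp; omega
  · simp [hj]

theorem update_succ_le {p : Fin d → ℕ} {i : Fin d} (hp : ∀ j, p j ≤ N) (h : p i < N) (j : Fin d) :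
    update p i (p i + 1) j ≤ N := by
  by_cases hj : j = i
  · subst hj; simpa using h
  · simpa [hj] using hp j

/-- `CommonWord m X p`: the unread parts have a common subsequence of length `m`. -/
def CommonWord (m : ℕ) (X : Fin d → Fin N → Fin k) (p : Fin d → ℕ) : Prop :=
  ∃ w : List (Fin k), w.length = m ∧ ∀ i, w.Sublist (unread X p i)

/-- The unread parts have a common subsequence of length `m`, except that the strings outside `D`
have to be able to produce the symbol `σ` first. -/
def CommonWordAfter (m : ℕ) (σ : Fin k) (D : Finset (Fin d)) (X : Fin d → Fin N → Fin k)
    (p : Fin d → ℕ) : Prop :=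
  ∃ w : List (Fin k), w.length = m ∧
    ∀ i, (if i ∈ D then w else σ :: w).Sublist (unread X p i)

/-- The unread parts, preceded by the pending symbols recorded in `s`, have a common subsequence of
length `m`. -/
def CommonWordPending (m : ℕ) (e : Bool → Fin k) (s : Fin d → Option Bool)
    (X : Fin d → Fin N → Fin k) (p : Fin d → ℕ) : Prop :=
  ∃ w : List (Fin k), w.length = m ∧
    ∀ i, w.Sublist ((s i).toList.map e ++ unread X p i)

theorem one_le_mul_sum_pow {K x : ℝ} {c : Fin d → ℝ} {p : Fin d → ℕ} (hK : 0 ≤ K)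
    (hx : 0 ≤ x) (hKx : 1 ≤ K * x ^ N) (hc : ∀ i, 0 ≤ c i) {i : Fin d} (hi : 1 ≤ c i)
    (hpi : p i = N) : 1 ≤ K * ∑ j, c j * x ^ p j := by
  refine hKx.trans (mul_le_mul_of_nonneg_left ?_ hK)
  calc x ^ N ≤ c i * x ^ p i := by
        rw [hpi]; exact le_mul_of_one_le_left (by positivity) hi
    _ ≤ ∑ j, c j * x ^ p j :=
        Finset.single_le_sum (f := fun j => c j * x ^ p j)
          (fun j _ => mul_nonneg (hc j) (pow_nonneg hx _)) (Finset.mem_univ i)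

/-- Failure bound for the phase in which the strings outside `D` wait for the symbol `σ`; `g` is the
exponential moment of the waiting time. -/
theorem unifProb_not_commonWordAfter_le [NeZero k] {K x g : ℝ} (hK : 0 ≤ K) (hx : 0 ≤ x)
    (hKx : 1 ≤ K * x ^ N) (hg1 : 1 ≤ g) (hg : k * g = x * (1 + (k - 1) * g)) {m : ℕ}
    (ih : ∀ p : Fin d → ℕ, (∀ i, p i ≤ N) →
      unifProb (fun X : Fin d → Fin N → Fin k => ¬CommonWord m X p) ≤ K * ∑ i, x ^ p i)
    (σ : Fin k) (D : Finset (Fin d)) (p : Fin d → ℕ) (hp : ∀ i, p i ≤ N) :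
    unifProb (fun X : Fin d → Fin N → Fin k => ¬CommonWordAfter m σ D X p) ≤
      K * ∑ i, (if i ∈ D then 1 else g) * x ^ p i := by
  induction hM : ∑ j, (N - p j) using Nat.strong_induction_on generalizing D p with
  | _ M IH =>
  by_cases hD : ∀ i, i ∈ D
  · simpa [CommonWordAfter, CommonWord, hD] using ih p hp
  push Not at hD
  obtain ⟨i, hi⟩ := hD
  have hk : (0 : ℝ) < k := by exact_mod_cast Nat.pos_of_ne_zero (NeZero.ne k)
  rcases (hp i).eq_or_lt with hpi | hpi
  · refine (unifProb_le_one _).trans (one_le_mul_sum_pow hK hx hKx (fun j => ?_) (i := i) ?_ hpi)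
    · split_ifs <;> linarith
    · simpa [hi] using hg1
  set p' := update p i (p i + 1) with hp'
  have hlt : ∑ j, (N - p' j) < M := hM ▸ sum_sub_update_lt hpi
  have hple : ∀ j, p' j ≤ N := update_succ_le hp hpi
  rw [unifProb_eq_expect_setSymbol _ i ⟨p i, hpi⟩]
  have step : ∀ a : Fin k, unifProb (fun X : Fin d → Fin N → Fin k =>
      ¬CommonWordAfter m σ D (setSymbol X i ⟨p i, hpi⟩ a) p) ≤
      K * ∑ j, (if j ∈ (if a = σ then insert i D else D) then 1 else g) * x ^ p' j := by
    intro a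
    refine (unifProb_mono fun X => ?_).trans (IH _ hlt _ p' hple rfl)
    refine mt ?_
    rintro ⟨w, hw, h⟩
    refine ⟨w, hw, fun j => ?_⟩
    by_cases hj : j = i
    · subst hj
      rw [unread_setSymbol_self]
      have := h j
      by_cases ha : a = σ
      · subst ha
        simpa [hi] using this
      · simp only [ha, hi, if_false] at this ⊢
        exact this.cons _
    · rw [unread_setSymbol_of_ne X p hj _ _ (p i + 1)]
      have := h j
      split_ifs at this <;> simp_all
  refine (Finset.expect_le_expect fun a _ => step a).trans ?_
  rw [← Finset.mul_expect, Finset.expect_sum_comm]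
  refine mul_le_mul_of_nonneg_left (Finset.sum_le_sum fun j _ => ?_) hK
  rw [← Finset.expect_mul]
  by_cases hj : j = i
  · subst hj
    have : ∀ a : Fin k, (if j ∈ (if a = σ then insert j D else D) then (1 : ℝ) else g) =
        g + if a = σ then 1 - g else 0 := by
      intro a
      by_cases ha : a = σ <;> simp [ha, hi]
    simp only [this, Fintype.expect_eq_sum_div_card, Finset.sum_add_distrib]
    simp only [Finset.sum_const, Finset.card_univ, Fintype.card_fin, nsmul_eq_mul,
      Finset.sum_ite_eq', Finset.mem_univ, if_true, hi, if_false, hp', update_self]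
    rw [div_mul_eq_mul_div, div_le_iff₀ hk, pow_succ]
    apply le_of_eq
    linear_combination (-x ^ p j) * hg
  · have : ∀ a : Fin k, (if j ∈ (if a = σ then insert i D else D) then (1 : ℝ) else g) =
        if j ∈ D then 1 else g := by
      intro a
      by_cases ha : a = σ <;> simp [ha, hj]
    simp [this, hp', hj]

/-- Fill in the undetermined entries of `s` from `b`. -/
def fillBits (s : Fin d → Option Bool) (b : Fin d → Bool) (i : Fin d) : Bool := (s i).getD (b i)

theorem fillBits_update (s : Fin d → Option Bool) (b : Fin d → Bool) (i : Fin d) (β : Bool)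
    (hs : s i = none) : fillBits (update s i (some β)) b = fillBits s (update b i β) := by
  funext j
  by_cases hj : j = i
  · subst hj; simp [fillBits, hs]
  · simp [fillBits, hj]

theorem expect_fillBits_update (f : (Fin d → Bool) → ℝ) (s : Fin d → Option Bool) (i : Fin d)
    (hs : s i = none) :
    (𝔼 b, f (fillBits (update s i (some true)) b)) +
      (𝔼 b, f (fillBits (update s i (some false)) b)) = 2 * 𝔼 b, f (fillBits s b) := by
  rw [expect_eq_expect_expect_set (fun b : Fin d → Bool => b i) (fun b β => update b i β)
    (by simp) (by simp) (by simp) fun b => f (fillBits s b)]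
  simp only [fillBits_update _ _ _ _ hs]
  rw [Fintype.expect_eq_sum_div_card (f := fun a => 𝔼 b, f (fillBits s (update b i a)))]
  simp only [Fintype.sum_bool, Fintype.card_bool]
  push_cast
  ring

/-- The waiting factor of the `i`-th string once all bits `b` are known. -/
noncomputable def bitWeight (g : ℝ) (b : Fin d → Bool) (i : Fin d) : ℝ :=
  if b i = majority b then 1 else g

/-- The pending bit obtained by reading a symbol. -/
def readBit (e : Bool → Fin k) (a : Fin k) : Option Bool :=
  if a = e true then some true else if a = e false then some false else none

theorem sum_readBit {e : Bool → Fin k} (he : e true ≠ e false) (F : Option Bool → ℝ) :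
    ∑ a, F (readBit e a) = F (some true) + F (some false) + (k - 2) * F none := by
  have : ∀ a, F (readBit e a) = F none + (if a = e true then F (some true) - F none else 0) +
      (if a = e false then F (some false) - F none else 0) := by
    intro a
    unfold readBit
    by_cases h1 : a = e true
    · simp [h1, he]
    · by_cases h2 : a = e false <;> simp [h2, he.symm, h1]
  simp only [this, Finset.sum_add_distrib, Finset.sum_ite_eq', Finset.mem_univ, if_true,
    Finset.sum_const, Finset.card_univ, Fintype.card_fin, nsmul_eq_mul]
  ring

/-- Failure bound for the phase in which every string looks for its first symbol among `e true`,
`e false`; `h` is the exponential moment of the waiting time. -/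
theorem unifProb_not_commonWordPending_le [NeZero k] {K x g h : ℝ} (hK : 0 ≤ K) (hx : 0 ≤ x)
    (hKx : 1 ≤ K * x ^ N) (hg1 : 1 ≤ g) (hg : k * g = x * (1 + (k - 1) * g))
    (hh1 : 1 ≤ h) (hh : k * h = x * (2 + (k - 2) * h)) {m : ℕ}
    (ih : ∀ p : Fin d → ℕ, (∀ i, p i ≤ N) →
      unifProb (fun X : Fin d → Fin N → Fin k => ¬CommonWord m X p) ≤ K * ∑ i, x ^ p i)
    {e : Bool → Fin k} (he : e true ≠ e false) (s : Fin d → Option Bool) (p : Fin d → ℕ)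
    (hp : ∀ i, p i ≤ N) :
    unifProb (fun X : Fin d → Fin N → Fin k => ¬CommonWordPending (m + 1) e s X p) ≤
      K * ∑ i, ((s i).elim h (fun _ => 1) * 𝔼 b, bitWeight g (fillBits s b) i) * x ^ p i := by
  induction hM : ∑ j, (N - p j) using Nat.strong_induction_on generalizing s p with
  | _ M IH =>
  have hW : ∀ (s : Fin d → Option Bool) j, 1 ≤ 𝔼 b, bitWeight g (fillBits s b) j := by
    intro s j
    refine Finset.le_expect Finset.univ_nonempty fun b _ => ?_
    unfold bitWeight
    split_ifs <;> linarith
  by_cases hs : ∀ i, s i ≠ none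
  · choose b hb using fun i => Option.ne_none_iff_exists'.1 (hs i)
    have hfill : ∀ b', fillBits s b' = b := fun b' => by funext i; simp [fillBits, hb]
    refine (unifProb_mono fun X => ?_).trans
      ((unifProb_not_commonWordAfter_le hK hx hKx hg1 hg ih (e (majority b))
        (Finset.univ.filter fun i => b i = majority b) p hp).trans (le_of_eq ?_))
    · refine mt ?_
      rintro ⟨w, hw, h⟩
      refine ⟨e (majority b) :: w, by simp [hw], fun i => ?_⟩
      have := h i
      by_cases hi : b i = majority b
      · simpa [hb, hi] using this
      · simp only [Finset.mem_filter, Finset.mem_univ, true_and, hi, if_false] at this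
        exact this.trans (List.sublist_append_right _ _)
    · simp [hfill, hb, bitWeight]
  push Not at hs
  obtain ⟨i, hi⟩ := hs
  have hk : (0 : ℝ) < k := by exact_mod_cast Nat.pos_of_ne_zero (NeZero.ne k)
  have hone : ∀ j, 1 ≤ (s j).elim h (fun _ => 1) := by
    intro j
    cases s j <;> simp [hh1]
  rcases (hp i).eq_or_lt with hpi | hpi
  · have h1 : ∀ j, 1 ≤ (s j).elim h (fun _ => 1) * 𝔼 b, bitWeight g (fillBits s b) j :=
      fun j => one_le_mul_of_one_le_of_one_le (hone j) (hW s j)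
    exact (unifProb_le_one _).trans (one_le_mul_sum_pow hK hx hKx
      (fun j => zero_le_one.trans (h1 j)) (h1 i) hpi)
  set p' := update p i (p i + 1) with hp'
  have hlt : ∑ j, (N - p' j) < M := hM ▸ sum_sub_update_lt hpi
  have hple : ∀ j, p' j ≤ N := update_succ_le hp hpi
  rw [unifProb_eq_expect_setSymbol _ i ⟨p i, hpi⟩]
  have step : ∀ a : Fin k, unifProb (fun X : Fin d → Fin N → Fin k =>
      ¬CommonWordPending (m + 1) e s (setSymbol X i ⟨p i, hpi⟩ a) p) ≤
      K * ∑ j, ((update s i (readBit e a) j).elim h (fun _ => 1) *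
        𝔼 b, bitWeight g (fillBits (update s i (readBit e a)) b) j) * x ^ p' j := by
    intro a
    refine (unifProb_mono fun X => ?_).trans (IH _ hlt _ p' hple rfl)
    refine mt ?_
    rintro ⟨w, hw, h⟩
    refine ⟨w, hw, fun j => ?_⟩
    have := h j
    by_cases hj : j = i
    · subst hj
      rw [unread_setSymbol_self, hi]
      simp only [update_self] at this
      refine this.trans ?_
      unfold readBit
      split_ifs with h1 h2
      · simp [h1, hp']
      · simp [h2, hp']
      · simp [hp']
    · rw [unread_setSymbol_of_ne X p hj _ _ (p i + 1)]
      simpa [hj] using this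
  refine (Finset.expect_le_expect fun a _ => step a).trans ?_
  rw [← Finset.mul_expect, Finset.expect_sum_comm]
  refine mul_le_mul_of_nonneg_left (Finset.sum_le_sum fun j _ => ?_) hK
  rw [← Finset.expect_mul, Fintype.expect_eq_sum_div_card,
    sum_readBit he fun o => (update s i o j).elim h (fun _ => 1) *
        𝔼 b, bitWeight g (fillBits (update s i o) b) j, Fintype.card_fin]
  have havg := expect_fillBits_update (fun b => bitWeight g b j) s i hi
  have hnone : update s i none = s := by rw [← hi, update_eq_self]
  rw [hnone, div_mul_eq_mul_div, div_le_iff₀ hk]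
  apply le_of_eq
  by_cases hj : j = i
  · subst hj
    simp only [update_self, hp', hi, Option.elim, one_mul, pow_succ]
    linear_combination (x ^ p j * x) * havg -
      (𝔼 b, bitWeight g (fillBits s b) j) * x ^ p j * hh
  · simp only [hp', update_of_ne hj]
    linear_combination ((s j).elim h (fun _ => 1) * x ^ p j) * havg

theorem expect_bitWeight {θ : ℝ} {i : Fin d}
    (hθ : 𝔼 b : Fin d → Bool, bitSign (b i) * bitSign (majority b) = θ) (g : ℝ) :
    𝔼 b : Fin d → Bool, bitWeight g b i = (1 + g) / 2 - (g - 1) / 2 * θ := by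
  have : ∀ b : Fin d → Bool, bitWeight g b i =
      (1 + g) / 2 - (g - 1) / 2 * (bitSign (b i) * bitSign (majority b)) := by
    intro b
    unfold bitWeight bitSign
    cases b i <;> cases majority b <;> simp <;> ring
  simp only [this, Finset.expect_sub_distrib, ← Finset.mul_expect, hθ]
  rw [Finset.expect_const Finset.univ_nonempty]

/-- Chernoff-type bound on the failure probability of the majority strategy; `A` is the exponential
moment of the number of symbols read per common letter. -/
theorem unifProb_not_commonWord_le [NeZero k] {x g h θ A : ℝ} (hx : 1 ≤ x) (hg1 : 1 ≤ g)
    (hg : k * g = x * (1 + (k - 1) * g)) (hh1 : 1 ≤ h) (hh : k * h = x * (2 + (k - 2) * h))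
    (hθ1 : θ ≤ 1)
    (hθ : ∀ i : Fin d, 𝔼 b : Fin d → Bool, bitSign (b i) * bitSign (majority b) = θ)
    (hA : A = h * ((1 + g) / 2 - (g - 1) / 2 * θ))
    {e : Bool → Fin k} (he : e true ≠ e false) (m : ℕ) (p : Fin d → ℕ) (hp : ∀ i, p i ≤ N) :
    unifProb (fun X : Fin d → Fin N → Fin k => ¬CommonWord m X p) ≤
      A ^ m / x ^ N * ∑ i, x ^ p i := by
  have hx0 : 0 < x := by linarith
  have hA1 : 1 ≤ A := by
    rw [hA]
    exact one_le_mul_of_one_le_of_one_le hh1 (by nlinarith)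
  induction m generalizing p with
  | zero =>
    rw [unifProb_eq_zero fun X => not_not.2 ⟨[], rfl, fun i => List.nil_sublist _⟩]
    positivity
  | succ m ih =>
    have hKx : 1 ≤ A ^ m / x ^ N * x ^ N := by
      rw [div_mul_cancel₀ _ (by positivity)]
      exact one_le_pow₀ hA1
    have key := unifProb_not_commonWordPending_le (by positivity) hx0.le hKx hg1 hg hh1 hh ih he
      (fun _ => none) p hp
    simp only [CommonWordPending, Option.toList_none, List.map_nil, List.nil_append] at key
    refine key.trans (le_of_eq ?_)
    have hfill : ∀ b : Fin d → Bool, fillBits (fun _ => none) b = b := fun b => rfl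
    simp only [hfill, expect_bitWeight (hθ _), Option.elim, ← hA, ← Finset.mul_sum]
    rw [pow_succ]
    ring

end Strategy

section Rate

/-- The exponential moment of the number of symbols read per common letter. -/
noncomputable def stepMoment (k θ x : ℝ) : ℝ :=
  2 * x / (k - (k - 2) * x) *
    ((1 + x / (k - (k - 1) * x)) / 2 - (x / (k - (k - 1) * x) - 1) / 2 * θ)

theorem hasDerivAt_stepMoment (k θ : ℝ) :
    HasDerivAt (stepMoment k θ) (k * (1 - θ / 2)) 1 := by
  unfold stepMoment
  have hid := hasDerivAt_id' (1 : ℝ)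
  have h1 : HasDerivAt (fun x : ℝ => 2 * x / (k - (k - 2) * x)) (k / 2) 1 :=
    ((hid.const_mul 2).fun_div ((hid.const_mul (k - 2)).const_sub k)
      (by norm_num)).congr_deriv (by norm_num; ring)
  have h2 : HasDerivAt (fun x : ℝ => x / (k - (k - 1) * x)) k 1 :=
    (hid.fun_div ((hid.const_mul (k - 1)).const_sub k) (by norm_num)).congr_deriv (by norm_num)
  exact (h1.fun_mul (((h2.const_add 1).div_const 2).fun_sub
    (((h2.sub_const 1).div_const 2).mul_const θ))).congr_deriv (by norm_num; ring)

theorem stepMoment_one (k θ : ℝ) : stepMoment k θ 1 = 1 := by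
  norm_num [stepMoment]

theorem exists_mul_log_stepMoment_lt {k θ r : ℝ} (hr : r * (k * (1 - θ / 2)) < 1) :
    ∃ x : ℝ, 1 < x ∧ (k - 1) * x < k ∧ r * Real.log (stepMoment k θ x) < Real.log x := by
  have hd : HasDerivAt (fun x => Real.log x - r * Real.log (stepMoment k θ x))
      (1 - r * (k * (1 - θ / 2))) 1 := by
    have h1 := (hasDerivAt_stepMoment k θ).log (by rw [stepMoment_one]; norm_num)
    exact ((Real.hasDerivAt_log one_ne_zero).fun_sub (h1.const_mul r)).congr_deriv (by
      rw [stepMoment_one]; norm_num)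
  have hs := hd.tendsto_slope.mono_left (nhdsGT_le_nhdsNE 1)
  have hpos := hs.eventually_const_lt (sub_pos.2 hr)
  have hc : ∀ᶠ x : ℝ in 𝓝[>] 1, (k - 1) * x < k := by
    have : Tendsto (fun x : ℝ => (k - 1) * x) (𝓝 1) (𝓝 ((k - 1) * 1)) :=
      tendsto_id.const_mul _
    exact (this.eventually_lt_const (by linarith)).filter_mono nhdsWithin_le_nhds
  obtain ⟨x, hx, hxk, hx1⟩ := (hpos.and (hc.and self_mem_nhdsWithin)).exists
  have hx1 : 1 < x := hx1
  refine ⟨x, hx1, hxk, ?_⟩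
  rw [slope_def_field, stepMoment_one] at hx
  have := (div_pos_iff_of_pos_right (sub_pos.2 hx1)).1 hx
  simpa using this

end Rate

section ExpectedLength

variable {d k : ℕ}

theorem bddAbove_commonSubsequence_length (hd : 1 ≤ d) (X : Fin d → List (Fin k)) :
    BddAbove {m : ℕ | ∃ w : List (Fin k), w.length = m ∧ ∀ i, w.Sublist (X i)} := by
  refine ⟨(X ⟨0, hd⟩).length, ?_⟩
  rintro _ ⟨w, rfl, h⟩
  exact (h _).length_le

theorem lcsLen_le (hd : 1 ≤ d) (X : Fin d → List (Fin k)) :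
    lcsLen d X ≤ (X ⟨0, hd⟩).length := by
  refine csSup_le ⟨0, [], rfl, fun i => List.nil_sublist _⟩ ?_
  rintro _ ⟨w, rfl, h⟩
  exact (h _).length_le

theorem expLCS_eq_expect (k d n : ℕ) :
    expLCS k d n = 𝔼 X : Fin d → Fin n → Fin k, (lcsLen d fun i => List.ofFn (X i) : ℝ) := by
  rw [Fintype.expect_eq_sum_div_card]
  rfl

theorem expLCS_le [NeZero k] (hd : 1 ≤ d) (n : ℕ) : expLCS k d n ≤ n := by
  rw [expLCS_eq_expect]
  refine Finset.expect_le Finset.univ_nonempty fun X _ => ?_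
  have := lcsLen_le hd fun i => List.ofFn (X i)
  rw [List.length_ofFn] at this
  exact_mod_cast this

theorem mul_one_sub_unifProb_le_expLCS [NeZero k] (hd : 1 ≤ d) (n m : ℕ) :
    m * (1 - unifProb fun X : Fin d → Fin n → Fin k => ¬CommonWord m X fun _ => 0) ≤
      expLCS k d n := by
  classical
  have h1 : (1 : ℝ) = 𝔼 _X : Fin d → Fin n → Fin k, (1 : ℝ) := by
    rw [Finset.expect_const Finset.univ_nonempty]
  rw [expLCS_eq_expect, unifProb, h1, ← Finset.expect_sub_distrib, Finset.mul_expect]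
  refine Finset.expect_le_expect fun X _ => ?_
  by_cases hX : CommonWord m X fun _ => 0
  · have : m ≤ lcsLen d fun i => List.ofFn (X i) :=
      le_csSup (bddAbove_commonSubsequence_length hd _) hX
    simpa [hX] using this
  · simp [hX]

theorem eventually_lt_expLCS_div (hk : 2 ≤ k) (hd : 1 ≤ d) {θ r r' : ℝ} (hr' : 0 < r')
    (hrr' : r < r') (hθ1 : θ ≤ 1)
    (hθ : ∀ i : Fin d, 𝔼 b : Fin d → Bool, bitSign (b i) * bitSign (majority b) = θ)
    (h : r' * (k * (1 - θ / 2)) < 1) :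
    ∀ᶠ n : ℕ in atTop, r < expLCS k d n / n := by
  have : NeZero k := ⟨by omega⟩
  have hk2 : (2 : ℝ) ≤ k := by exact_mod_cast hk
  obtain ⟨x, hx1, hxk, hlog⟩ := exists_mul_log_stepMoment_lt h
  have hx0 : 0 < x := by linarith
  set g := x / (k - (k - 1) * x) with hg
  set u := 2 * x / (k - (k - 2) * x) with hu
  set A := stepMoment k θ x with hA
  have hgpos : 0 < k - (k - 1) * x := by linarith
  have hupos : 0 < k - (k - 2) * x := by linarith
  have hg1 : 1 ≤ g := by
    rw [hg, le_div_iff₀ hgpos]; nlinarith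
  have hu1 : 1 ≤ u := by
    rw [hu, le_div_iff₀ hupos]; nlinarith
  have hge : k * g = x * (1 + (k - 1) * g) := by
    have : g * (k - (k - 1) * x) = x := div_mul_cancel₀ _ hgpos.ne'
    linear_combination this
  have hue : k * u = x * (2 + (k - 2) * u) := by
    have : u * (k - (k - 2) * x) = 2 * x := div_mul_cancel₀ _ hupos.ne'
    linear_combination this
  have hA1 : 1 ≤ A := by
    change 1 ≤ u * ((1 + g) / 2 - (g - 1) / 2 * θ)
    exact one_le_mul_of_one_le_of_one_le hu1 (by nlinarith)
  let e : Bool → Fin k := fun b => if b then ⟨0, by omega⟩ else ⟨1, by omega⟩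
  have he : e true ≠ e false := by simp [e]
  set q := Real.exp (r' * Real.log A - Real.log x) with hq
  have hq1 : q < 1 := by rw [hq, Real.exp_lt_one_iff]; linarith
  have hq0 : 0 ≤ q := (Real.exp_pos _).le
  have hbound : ∀ n : ℕ, A ^ ⌊r' * n⌋₊ / x ^ n ≤ q ^ n := by
    intro n
    have hm : (⌊r' * n⌋₊ : ℝ) ≤ r' * n := Nat.floor_le (by positivity)
    have hA0 : 0 < A := by linarith
    have hApow : A ^ ⌊r' * n⌋₊ = Real.exp (⌊r' * n⌋₊ * Real.log A) := by
      rw [Real.exp_nat_mul, Real.exp_log hA0]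
    have hxpow : x ^ n = Real.exp (n * Real.log x) := by rw [Real.exp_nat_mul, Real.exp_log hx0]
    rw [div_le_iff₀ (by positivity), hApow, hxpow, hq, ← Real.exp_nat_mul, ← Real.exp_add,
      Real.exp_le_exp]
    have := mul_le_mul_of_nonneg_right hm (Real.log_nonneg hA1)
    linarith
  have hqlim : Tendsto (fun n : ℕ => 1 - d * q ^ n) atTop (𝓝 1) := by
    simpa using ((tendsto_pow_atTop_nhds_zero_of_lt_one hq0 hq1).const_mul (d : ℝ)).const_sub 1
  have hlim : Tendsto (fun n : ℕ => (r' - 1 / (n : ℝ)) * (1 - d * q ^ n)) atTop (𝓝 r') := by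
    simpa using (tendsto_one_div_atTop_nhds_zero_nat.const_sub r').mul hqlim
  filter_upwards [hlim.eventually_const_lt hrr', hqlim.eventually_const_lt zero_lt_one,
    eventually_gt_atTop 0] with n hn hn1 hn0
  have hn0' : (0 : ℝ) < n := by exact_mod_cast hn0
  refine hn.trans_le ?_
  rw [le_div_iff₀ hn0']
  refine le_trans ?_ (mul_one_sub_unifProb_le_expLCS hd n ⌊r' * n⌋₊)
  have hp := unifProb_not_commonWord_le hx1.le hg1 hge hu1 hue hθ1 hθ (A := A) rfl he
    ⌊r' * n⌋₊ (fun _ => 0) (fun _ => Nat.zero_le n)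
  simp only [pow_zero, Finset.sum_const, Finset.card_univ, Fintype.card_fin, nsmul_eq_mul,
    mul_one] at hp
  have hp' := hp.trans (mul_le_mul_of_nonneg_right (hbound n) (Nat.cast_nonneg d))
  have hfl : r' * n - 1 ≤ ⌊r' * n⌋₊ := (Nat.sub_one_lt_floor _).le
  calc (r' - 1 / n) * (1 - d * q ^ n) * n = (r' * n - 1) * (1 - d * q ^ n) := by
        field_simp
    _ ≤ ⌊r' * n⌋₊ * (1 - d * q ^ n) := mul_le_mul_of_nonneg_right hfl hn1.le
    _ ≤ _ := mul_le_mul_of_nonneg_left (by linarith) (Nat.cast_nonneg _)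

end ExpectedLength

/-- There exist absolute constants `c₀, c₁ > 0` such that for all integers `k ≥ 2` and
`d ≥ c₀ · log₂ k`, `liminf_{n→∞} E_{k,d}(n)/n ≥ (1/k)·(1 + c₁/√d)`. -/
theorem kary_lower_bound :
    ∃ c₀ : ℝ, 0 < c₀ ∧ ∃ c₁ : ℝ, 0 < c₁ ∧ ∀ k d : ℕ, 2 ≤ k →
      c₀ * Real.logb 2 k ≤ d →
      (1 / k) * (1 + c₁ / Real.sqrt d) ≤
        Filter.liminf (fun n : ℕ => expLCS k d n / n) Filter.atTop := by
  refine ⟨1, one_pos, 1 / 32, by norm_num, fun k d hk hkd => ?_⟩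
  have : NeZero k := ⟨by omega⟩
  have hk0 : (0 : ℝ) < k := by exact_mod_cast (by omega : 0 < k)
  have hd : 1 ≤ d := by
    have h1 : 0 < Real.logb 2 k :=
      Real.logb_pos (by norm_num) (by exact_mod_cast (by omega : 1 < k))
    have h2 : (0 : ℝ) < d := by linarith
    exact_mod_cast h2
  have hs : 0 < √(d : ℝ) := Real.sqrt_pos.2 (by exact_mod_cast hd)
  obtain ⟨θ, hθ0, hθ1, hθ⟩ := exists_majority_correlation hd
  set v := 1 / √(d : ℝ) with hv
  have hv0 : 0 < v := by positivity
  have e1 : 1 / 32 / √(d : ℝ) = v / 32 := by rw [hv]; ring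
  have e2 : 1 / (4 * √(d : ℝ)) = v / 4 := by rw [hv]; field_simp
  rw [e2] at hθ0
  rw [e1]
  have hev := eventually_lt_expLCS_div (r := 1 / k * (1 + v / 32)) (r' := 1 / k * (1 + v / 16))
    hk hd (by positivity) (mul_lt_mul_of_pos_left (by linarith) (by positivity)) hθ1 hθ (by
      have : 1 / (k : ℝ) * (1 + v / 16) * (k * (1 - θ / 2)) = (1 + v / 16) * (1 - θ / 2) := by
        field_simp
      rw [this]
      nlinarith)
  refine Filter.le_liminf_of_le ?_ (hev.mono fun n hn => hn.le)
  refine Filter.IsBoundedUnder.isCoboundedUnder_ge ⟨1, ?_⟩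
  simp only [Filter.eventually_map]
  exact Filter.Eventually.of_forall fun n =>
    div_le_one_of_le₀ (expLCS_le hd n) (Nat.cast_nonneg n)
end

section
/- Let k ≥ 2 and d be integers with d ≥ 16·log k (log base 2), set ε = 4·√(ln k / d), and let ℓ = ⌈(n/k)·(1 + ε)⌉. Then for all sufficiently large n, if X^1, …, X^d are independent uniformly random strings in [k]^n, Pr[LCS(X^1, …, X^d) ≥ ℓ] ≤ n^d · k^{−2n/k}. -/
open Classical in
/-- `prLCSge k d n ℓ` is the probability that `d` independent uniformly random strings
of length `n` over an alphabet of size `k` have an LCS of length at least `ℓ`. -/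
noncomputable def prLCSge (k d n ℓ : ℕ) : ℝ :=
  ((Finset.univ.filter (fun X : Fin d → Fin n → Fin k =>
      ℓ ≤ lcsLen d (fun i => List.ofFn (X i)))).card : ℝ) /
    (Fintype.card (Fin d → Fin n → Fin k) : ℝ)

/-- If the longest common subsequence has length at least `ℓ`, then some string of length
exactly `ℓ` is a common subsequence. -/
theorem exists_common_sublist_of_le_lcsLen {k d ℓ : ℕ} (hd : 0 < d)
    {X : Fin d → List (Fin k)} (h : ℓ ≤ lcsLen d X) :
    ∃ v : Fin ℓ → Fin k, ∀ i, (List.ofFn v).Sublist (X i) := by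
  have hmem : lcsLen d X ∈
      {m : ℕ | ∃ w : List (Fin k), w.length = m ∧ ∀ i : Fin d, w.Sublist (X i)} := by
    refine Nat.sSup_mem ⟨0, [], rfl, fun i => List.nil_sublist _⟩ ⟨(X ⟨0, hd⟩).length, ?_⟩
    rintro m ⟨w, rfl, hw⟩
    exact (hw _).length_le
  obtain ⟨w, hw, hs⟩ := hmem
  have hlen : (w.take ℓ).length = ℓ := by simp [hw, h]
  refine ⟨fun i => (w.take ℓ).get (i.cast hlen.symm), fun i => ?_⟩
  have hv : List.ofFn (fun i : Fin ℓ => (w.take ℓ).get (i.cast hlen.symm)) = w.take ℓ := by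
    apply List.ext_get
    · simp [hw, h]
    · intro m h₁ h₂
      simp
  rw [hv]
  exact (List.take_sublist _ _).trans (hs i)

open Classical in
/-- The number of strings of length `n` over `Fin k` that contain `w` as a subsequence. -/
noncomputable def superseqCount (k n : ℕ) (w : List (Fin k)) : ℕ :=
  (Finset.univ.filter (fun x : Fin n → Fin k => w.Sublist (List.ofFn x))).card

theorem superseqCount_succ_cons {k n : ℕ} (a : Fin k) (w : List (Fin k)) :
    superseqCount k (n + 1) (a :: w) =
      superseqCount k n w + (k - 1) * superseqCount k n (a :: w) := by
  classical
  have key : superseqCount k (n + 1) (a :: w) =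
      ∑ b : Fin k, if b = a then superseqCount k n w else superseqCount k n (a :: w) := by
    simp only [superseqCount, Finset.card_filter]
    rw [← (Fin.consEquiv (fun _ : Fin (n + 1) => Fin k)).sum_comp, Fintype.sum_prod_type]
    refine Finset.sum_congr rfl fun b _ => ?_
    split_ifs with hb
    · subst hb
      simp [Fin.consEquiv, List.ofFn_succ]
    · refine Finset.sum_congr rfl fun x _ => ?_
      have : (a :: w).Sublist (b :: List.ofFn x) ↔ (a :: w).Sublist (List.ofFn x) := by
        rw [List.sublist_cons_iff]
        simp [Ne.symm hb]
      simp [Fin.consEquiv, List.ofFn_succ, this]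
  rw [key, ← Finset.add_sum_erase _ _ (Finset.mem_univ a), if_pos rfl,
    Finset.sum_congr rfl fun b hb => if_neg (Finset.ne_of_mem_erase hb)]
  simp

/-- An exponential-moment bound on the number of supersequences of `w`. -/
theorem superseqCount_mul_pow_le {k : ℕ} {t : ℝ} (ht : 1 ≤ t) (n : ℕ) (w : List (Fin k)) :
    (superseqCount k n w : ℝ) * t ^ w.length ≤ (k - 1 + t) ^ n := by
  have hk0 : (0 : ℝ) ≤ k := k.cast_nonneg
  induction n generalizing w with
  | zero =>
    cases w with
    | nil => simp [superseqCount]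
    | cons a w => simp [superseqCount]
  | succ n ih =>
    cases w with
    | nil =>
      simp only [superseqCount, List.nil_sublist, Finset.filter_true, Finset.card_univ,
        Fintype.card_fun, Fintype.card_fin, List.length_nil, pow_zero, mul_one, Nat.cast_pow]
      exact pow_le_pow_left₀ hk0 (by linarith) _
    | cons a w =>
      have hk : 1 ≤ k := Nat.one_le_of_lt a.isLt
      have hk1 : (0 : ℝ) ≤ k - 1 := by
        have : (1 : ℝ) ≤ k := by exact_mod_cast hk
        linarith
      rw [superseqCount_succ_cons]
      push_cast [Nat.cast_sub hk]
      calc ((superseqCount k n w : ℝ) + (k - 1) * superseqCount k n (a :: w)) *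
            t ^ (a :: w).length
          = t * (superseqCount k n w * t ^ w.length) +
            (k - 1) * (superseqCount k n (a :: w) * t ^ (a :: w).length) := by
              rw [List.length_cons]; ring
        _ ≤ t * (k - 1 + t) ^ n + (k - 1) * (k - 1 + t) ^ n := by
              gcongr
              · exact ih w
              · exact ih (a :: w)
        _ = (k - 1 + t) ^ (n + 1) := by ring

/-- The union bound over all candidate common subsequences of length `ℓ`. -/
theorem prLCSge_le_of_superseqCount_le {k d n ℓ : ℕ} (hd : 0 < d) {p : ℝ}
    (hp : ∀ w : List (Fin k), w.length = ℓ → (superseqCount k n w : ℝ) / (k : ℝ) ^ n ≤ p) :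
    prLCSge k d n ℓ ≤ (k : ℝ) ^ ℓ * p ^ d := by
  classical
  have hcard : (Finset.univ.filter (fun X : Fin d → Fin n → Fin k =>
      ℓ ≤ lcsLen d (fun i => List.ofFn (X i)))).card ≤
      ∑ v : Fin ℓ → Fin k, superseqCount k n (List.ofFn v) ^ d := by
    calc _ ≤ (Finset.univ.biUnion fun v : Fin ℓ → Fin k =>
          Fintype.piFinset fun _ : Fin d => Finset.univ.filter
            fun x : Fin n → Fin k => (List.ofFn v).Sublist (List.ofFn x)).card := by
          refine Finset.card_le_card fun X hX => ?_
          obtain ⟨v, hv⟩ := exists_common_sublist_of_le_lcsLen hd (Finset.mem_filter.1 hX).2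
          simp only [Finset.mem_biUnion, Finset.mem_univ, true_and, Fintype.mem_piFinset,
            Finset.mem_filter]
          exact ⟨v, hv⟩
      _ ≤ _ := Finset.card_biUnion_le
      _ = _ := by
          refine Finset.sum_congr rfl fun v _ => ?_
          rw [Fintype.card_piFinset_const]
          simp only [superseqCount]
  have hden : (Fintype.card (Fin d → Fin n → Fin k) : ℝ) = ((k : ℝ) ^ n) ^ d := by
    simp
  calc prLCSge k d n ℓ
      ≤ (∑ v : Fin ℓ → Fin k, (superseqCount k n (List.ofFn v) : ℝ) ^ d) /
          ((k : ℝ) ^ n) ^ d := by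
        rw [← hden, prLCSge]
        gcongr
        exact_mod_cast hcard
    _ = ∑ v : Fin ℓ → Fin k, ((superseqCount k n (List.ofFn v) : ℝ) / (k : ℝ) ^ n) ^ d := by
        rw [Finset.sum_div]
        simp only [div_pow]
    _ ≤ ∑ _v : Fin ℓ → Fin k, p ^ d := by
        gcongr with v
        exact hp _ (List.length_ofFn ..)
    _ = (k : ℝ) ^ ℓ * p ^ d := by simp

/-- A Chernoff bound for the fraction of strings containing a given long subsequence. -/
theorem superseqCount_div_le_exp {k n : ℕ} (hk : 0 < k) {ε : ℝ} (hε : 0 ≤ ε) (hε1 : ε ≤ 1)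
    (w : List (Fin k)) (hw : (n : ℝ) / k * (1 + ε) ≤ w.length) :
    (superseqCount k n w : ℝ) / (k : ℝ) ^ n ≤ Real.exp (-((n : ℝ) / k * (ε ^ 2 / 4))) := by
  have hk0 : (0 : ℝ) < k := by exact_mod_cast hk
  have hquad : Real.exp (ε / 2) - 1 ≤ ε / 2 + (ε / 2) ^ 2 := by
    have h := Real.abs_exp_sub_one_sub_id_le (x := ε / 2) (by rw [abs_le]; constructor <;> linarith)
    linarith [le_abs_self (Real.exp (ε / 2) - 1 - ε / 2)]
  have hmom := superseqCount_mul_pow_le (k := k) (Real.one_le_exp (x := ε / 2) (by linarith)) n w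
  have hbase : (k : ℝ) - 1 + Real.exp (ε / 2) ≤
      k * Real.exp ((ε / 2 + (ε / 2) ^ 2) / k) := by
    have h := Real.add_one_le_exp ((ε / 2 + (ε / 2) ^ 2) / k)
    calc (k : ℝ) - 1 + Real.exp (ε / 2) ≤ k * ((ε / 2 + (ε / 2) ^ 2) / k + 1) := by
          field_simp
          linarith
      _ ≤ _ := by gcongr
  have hpow : ((k : ℝ) - 1 + Real.exp (ε / 2)) ^ n ≤
      (k : ℝ) ^ n * Real.exp (n * ((ε / 2 + (ε / 2) ^ 2) / k)) := by
    rw [Real.exp_nat_mul, ← mul_pow]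
    have h1 : 1 ≤ (k : ℝ) := by exact_mod_cast hk
    exact pow_le_pow_left₀ (by linarith [Real.exp_pos (ε / 2)]) hbase n
  rw [← Real.exp_nat_mul] at hmom
  rw [div_le_iff₀ (by positivity)]
  have hexp : Real.exp (n * ((ε / 2 + (ε / 2) ^ 2) / k)) ≤
      Real.exp (-((n : ℝ) / k * (ε ^ 2 / 4))) * Real.exp (w.length * (ε / 2)) := by
    rw [← Real.exp_add, Real.exp_le_exp]
    have h := mul_le_mul_of_nonneg_right hw (by linarith : 0 ≤ ε / 2)
    have e : (n : ℝ) * ((ε / 2 + (ε / 2) ^ 2) / k) =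
      -((n : ℝ) / k * (ε ^ 2 / 4)) + (n : ℝ) / k * (1 + ε) * (ε / 2) := by ring
    linarith
  refine le_of_mul_le_mul_right ?_ (Real.exp_pos (w.length * (ε / 2)))
  calc _ ≤ _ := hmom
    _ ≤ _ := hpow
    _ ≤ (k : ℝ) ^ n * (Real.exp (-((n : ℝ) / k * (ε ^ 2 / 4))) *
          Real.exp (w.length * (ε / 2))) := by gcongr
    _ = _ := by ring

/-- For `k ≥ 2`, `d ≥ 16·log₂ k`, `ε = 4·√(ln k / d)` and `ℓ = ⌈(n/k)·(1+ε)⌉`,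
for all sufficiently large `n` the probability that the LCS of `d` independent
uniformly random strings in `[k]^n` is at least `ℓ` is at most `n^d · k^{−2n/k}`. -/
theorem lcs_tail_bound_explicit (k d : ℕ) (hk : 2 ≤ k)
    (hd : 16 * Real.logb 2 k ≤ d) :
    ∀ᶠ n : ℕ in Filter.atTop,
      prLCSge k d n ⌈((n : ℝ) / k) * (1 + 4 * Real.sqrt (Real.log k / d))⌉₊
        ≤ (n : ℝ) ^ d * (k : ℝ) ^ (-(2 * (n : ℝ) / k)) := by
  have hk1 : (1 : ℝ) < k := by exact_mod_cast hk
  have hk0 : (0 : ℝ) < k := by linarith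
  have hlog : 0 < Real.log k := Real.log_pos hk1
  have hlogd : 16 * Real.log k ≤ d := by
    refine le_trans ?_ hd
    have h2 : Real.log 2 ≤ 1 := by linarith [Real.log_two_lt_d9]
    have : Real.log k ≤ Real.logb 2 k := by
      rw [Real.logb, le_div_iff₀ (Real.log_pos one_lt_two)]
      nlinarith
    linarith
  have hd0 : (0 : ℝ) < d := by linarith
  have hdpos : 0 < d := by exact_mod_cast hd0
  set ε : ℝ := 4 * Real.sqrt (Real.log k / d) with hεdef
  have hε0 : 0 ≤ ε := by positivity
  have hεsq : ε ^ 2 = 16 * (Real.log k / d) := by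
    rw [hεdef, mul_pow, Real.sq_sqrt (by positivity)]
    norm_num
  have hε1 : ε ≤ 1 := by
    have : ε ^ 2 ≤ 1 := by
      rw [hεsq, ← mul_div_assoc, div_le_one hd0]
      exact hlogd
    nlinarith
  filter_upwards [Filter.eventually_ge_atTop k] with n hn
  have hnk : (k : ℝ) ≤ (n : ℝ) ^ d := by
    exact_mod_cast hn.trans (Nat.le_self_pow hdpos.ne' n)
  set ℓ := ⌈(n : ℝ) / k * (1 + ε)⌉₊ with hℓ
  have hceil : (ℓ : ℝ) ≤ 2 * n / k + 1 := by
    have h := (Nat.ceil_lt_add_one (a := (n : ℝ) / k * (1 + ε)) (by positivity)).le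
    have h' : (n : ℝ) / k * (1 + ε) ≤ (n : ℝ) / k * 2 := by gcongr; linarith
    rw [← hℓ] at h
    have e : 2 * (n : ℝ) / k = (n : ℝ) / k * 2 := by ring
    linarith
  have hpr := prLCSge_le_of_superseqCount_le (n := n) (ℓ := ℓ) hdpos fun w hw =>
    superseqCount_div_le_exp (n := n) (by omega : 0 < k) hε0 hε1 w (by
      rw [hw]; exact Nat.le_ceil _)
  have hchernoff : Real.exp (-((n : ℝ) / k * (ε ^ 2 / 4))) ^ d =
      (k : ℝ) ^ (-(4 * (n : ℝ) / k)) := by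
    rw [← Real.exp_nat_mul, Real.rpow_def_of_pos hk0, hεsq]
    congr 1
    field_simp
    norm_num
  calc _ ≤ _ := hpr
    _ = (k : ℝ) ^ ((ℓ : ℝ) + -(4 * (n : ℝ) / k)) := by
        rw [hchernoff, Real.rpow_add hk0, Real.rpow_natCast]
    _ ≤ (k : ℝ) ^ (1 + -(2 * (n : ℝ) / k)) := by
        refine Real.rpow_le_rpow_of_exponent_le hk1.le ?_
        have e : 4 * (n : ℝ) / k = 2 * n / k + 2 * n / k := by ring
        linarith
    _ = k * (k : ℝ) ^ (-(2 * (n : ℝ) / k)) := by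
        rw [Real.rpow_add hk0, Real.rpow_one]
    _ ≤ _ := by gcongr
end

section
/- Let k ≥ 2 and d be integers with d ≥ 16·log k (log base 2). Then for all sufficiently large n, if X^1, …, X^d are independent uniformly random strings in [k]^n, E[LCS(X^1, …, X^d)] ≤ (n/k)·(1 + 4·√(ln k / d)) + 1 + n^{d+1}·k^{−2n/k}. -/
open Finset in
/-- Chernoff-type count of the strings of length `n` that contain a given word as a subsequence. -/
theorem sum_ite_sublist_mul_pow_le {k : ℕ} {z : ℝ} (hz : 1 ≤ z) (n : ℕ) (w : List (Fin k)) :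
    (∑ x : Fin n → Fin k, if w.Sublist (List.ofFn x) then (1 : ℝ) else 0) * z ^ w.length ≤
      (k - 1 + z) ^ n := by
  induction n generalizing w with
  | zero => cases w <;> simp
  | succ n ih =>
    cases w with
    | nil =>
      simp only [List.nil_sublist, if_true, List.length_nil, pow_zero, mul_one, sum_const,
        card_univ, Fintype.card_fun, Fintype.card_fin, nsmul_eq_mul, Nat.cast_pow]
      exact pow_le_pow_left₀ (by positivity) (by linarith) _
    | cons a w =>
      have hsplit : (∑ x : Fin (n + 1) → Fin k,
            if (a :: w).Sublist (List.ofFn x) then (1 : ℝ) else 0) =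
          ∑ b : Fin k, ∑ x : Fin n → Fin k,
            if (a :: w).Sublist (b :: List.ofFn x) then (1 : ℝ) else 0 := by
        rw [← Fintype.sum_prod_type',
          ← Equiv.sum_comp (Fin.consEquiv fun _ : Fin (n + 1) => Fin k)]
        simp [Fin.consEquiv, List.ofFn_succ]
      have hne : ∀ b ∈ univ.erase a, (∑ x : Fin n → Fin k,
            if (a :: w).Sublist (b :: List.ofFn x) then (1 : ℝ) else 0) * z ^ (w.length + 1) ≤
          (k - 1 + z) ^ n := by
        intro b hb
        have hab : a ≠ b := (ne_of_mem_erase hb).symm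
        simpa [List.cons_sublist_cons', hab] using ih (a :: w)
      have hcard : ((univ.erase a).card : ℝ) = k - 1 := by
        rw [card_erase_of_mem (mem_univ a), card_univ, Fintype.card_fin,
          Nat.cast_sub (by have := a.2; omega)]
        simp
      have hrest := sum_le_card_nsmul _ _ _ hne
      rw [nsmul_eq_mul, hcard, ← sum_mul] at hrest
      have hfirst := mul_le_mul_of_nonneg_right (ih w) (zero_le_one.trans hz)
      rw [hsplit, ← add_sum_erase _ _ (mem_univ a)]
      simp only [List.cons_sublist_cons, List.length_cons]
      calc _ = (∑ x : Fin n → Fin k, if w.Sublist (List.ofFn x) then (1 : ℝ) else 0) *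
              z ^ w.length * z + (∑ b ∈ univ.erase a, ∑ x : Fin n → Fin k,
            if (a :: w).Sublist (b :: List.ofFn x) then (1 : ℝ) else 0) * z ^ (w.length + 1) := by
              ring
        _ ≤ (k - 1 + z) ^ n * z + (k - 1) * (k - 1 + z) ^ n := add_le_add hfirst hrest
        _ = _ := by ring

/-- Either the longest common subsequence is shorter than `l + 1`, or some word of length `l + 1`
is a common subsequence. -/
theorem lcsLen_ofFn_le {k d n : ℕ} (hd : 0 < d) (l : ℕ) (X : Fin d → Fin n → Fin k) :
    (lcsLen d (fun i => List.ofFn (X i)) : ℝ) ≤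
      l + n * ∑ w : Fin (l + 1) → Fin k, ∏ i : Fin d,
        if (List.ofFn w).Sublist (List.ofFn (X i)) then (1 : ℝ) else 0 := by
  have hnonneg : ∀ w : Fin (l + 1) → Fin k, 0 ≤ ∏ i : Fin d,
      if (List.ofFn w).Sublist (List.ofFn (X i)) then (1 : ℝ) else 0 := fun w =>
    Finset.prod_nonneg fun i _ => by split_ifs <;> simp
  have hbound : ∀ m ∈ {m : ℕ | ∃ w : List (Fin k), w.length = m ∧
      ∀ i : Fin d, w.Sublist (List.ofFn (X i))}, m ≤ n := by
    rintro m ⟨w, rfl, hw⟩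
    simpa using (hw ⟨0, hd⟩).length_le
  obtain ⟨w, hlen, hw⟩ := Nat.sSup_mem (s := {m : ℕ | ∃ w : List (Fin k), w.length = m ∧
      ∀ i : Fin d, w.Sublist (List.ofFn (X i))})
    ⟨0, [], rfl, fun i => List.nil_sublist _⟩ ⟨n, hbound⟩
  change w.length = lcsLen d (fun i => List.ofFn (X i)) at hlen
  rw [← hlen]
  rcases le_or_gt w.length l with hl | hl
  · have : (w.length : ℝ) ≤ l := by exact_mod_cast hl
    have := mul_nonneg (Nat.cast_nonneg (α := ℝ) n)
      (Finset.sum_nonneg (s := Finset.univ) fun w _ => hnonneg w)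
    linarith
  · have hn : (w.length : ℝ) ≤ n := by exact_mod_cast hbound _ ⟨w, rfl, hw⟩
    have hle : l + 1 ≤ w.length := hl
    let v : Fin (l + 1) → Fin k := fun i => w[(i : ℕ)]
    have hv : List.ofFn v = w.take (l + 1) := by
      apply List.ext_getElem
      · simp [hle]
      · intro i h₁ h₂
        simp [v, -List.ofFn_succ]
    have hone : (1 : ℝ) ≤ ∑ w : Fin (l + 1) → Fin k, ∏ i : Fin d,
        if (List.ofFn w).Sublist (List.ofFn (X i)) then (1 : ℝ) else 0 := by
      refine le_trans (le_of_eq ?_)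
        (Finset.single_le_sum (fun w _ => hnonneg w) (Finset.mem_univ v))
      refine (Finset.prod_eq_one fun i _ => if_pos ?_).symm
      rw [hv]
      exact (List.take_sublist _ _).trans (hw i)
    nlinarith [Nat.cast_nonneg (α := ℝ) n, Nat.cast_nonneg (α := ℝ) l]

/-- The first moment bound on the expected LCS length. -/
theorem expLCS_le_add {k d n : ℕ} (hk : 0 < k) (hd : 0 < d) (l : ℕ) {z : ℝ} (hz : 1 ≤ z) :
    expLCS k d n ≤
      l + n * ((k : ℝ) ^ (l + 1) * (((1 + (z - 1) / k) ^ n / z ^ (l + 1)) ^ d)) := by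
  have hk' : (0 : ℝ) < k := by exact_mod_cast hk
  have hz' : 0 < z := zero_lt_one.trans_le hz
  have hcount : ∀ w : Fin (l + 1) → Fin k,
      (∑ x : Fin n → Fin k, if (List.ofFn w).Sublist (List.ofFn x) then (1 : ℝ) else 0) ^ d ≤
        ((k - 1 + z) ^ n / z ^ (l + 1)) ^ d := by
    intro w
    refine pow_le_pow_left₀ (Finset.sum_nonneg fun x _ => by split_ifs <;> simp) ?_ d
    rw [le_div_iff₀ (by positivity)]
    simpa using sum_ite_sublist_mul_pow_le hz n (List.ofFn w)
  have hcard : (Fintype.card (Fin d → Fin n → Fin k) : ℝ) = ((k : ℝ) ^ n) ^ d := by simp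
  have hbase : (1 + (z - 1) / k : ℝ) = (k - 1 + z) / k := by field_simp; ring
  rw [expLCS, hcard, div_le_iff₀ (by positivity)]
  calc _ ≤ ∑ X : Fin d → Fin n → Fin k, (l + n * ∑ w : Fin (l + 1) → Fin k, ∏ i : Fin d,
        if (List.ofFn w).Sublist (List.ofFn (X i)) then (1 : ℝ) else 0) :=
        Finset.sum_le_sum fun X _ => lcsLen_ofFn_le hd l X
    _ = l * ((k : ℝ) ^ n) ^ d + n * ∑ w : Fin (l + 1) → Fin k,
        (∑ x : Fin n → Fin k,
          if (List.ofFn w).Sublist (List.ofFn x) then (1 : ℝ) else 0) ^ d := by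
        rw [Finset.sum_add_distrib, ← Finset.mul_sum, Finset.sum_comm, Finset.sum_const,
          Finset.card_univ, nsmul_eq_mul, hcard, mul_comm (l : ℝ)]
        simp_rw [Fintype.sum_pow]
    _ ≤ l * ((k : ℝ) ^ n) ^ d + n * ∑ w : Fin (l + 1) → Fin k,
        ((k - 1 + z) ^ n / z ^ (l + 1)) ^ d := by
        exact add_le_add_right (mul_le_mul_of_nonneg_left
          (Finset.sum_le_sum fun w _ => hcount w) (Nat.cast_nonneg n)) _
    _ = _ := by
        rw [Finset.sum_const, Finset.card_univ, Fintype.card_fun, Fintype.card_fin,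
          Fintype.card_fin, nsmul_eq_mul, hbase]
        push_cast
        simp only [div_pow]
        field_simp

/-- Chernoff's bound for the upper tail, in exponential-moment form. -/
theorem one_add_div_pow_div_pow_le {n k m : ℕ} {δ : ℝ} (h₀ : 0 ≤ δ) (h₁ : δ ≤ 1)
    (hm : (1 + δ) * (n / k) ≤ m) :
    (1 + δ / k) ^ n / (1 + δ) ^ m ≤ Real.exp (-(δ ^ 2 / 3 * (n / k))) := by
  have hμ : (0 : ℝ) ≤ n / k := by positivity
  have hlog := Real.le_log_one_add_of_nonneg h₀
  have hlog₀ : 0 ≤ Real.log (1 + δ) := Real.log_nonneg (by linarith)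
  have hnum : (1 + δ / k) ^ n ≤ Real.exp (δ * (n / k)) := by
    calc (1 + δ / k) ^ n ≤ Real.exp (δ / k) ^ n := by
          refine pow_le_pow_left₀ (by positivity) ?_ n
          linarith [Real.add_one_le_exp (δ / k)]
      _ = Real.exp (δ * (n / k)) := by rw [← Real.exp_nat_mul]; congr 1; ring
  have hden : (1 + δ) ^ m = Real.exp (m * Real.log (1 + δ)) := by
    rw [Real.exp_nat_mul, Real.exp_log (by linarith)]
  have hrate : δ + δ ^ 2 / 3 ≤ (1 + δ) * Real.log (1 + δ) := by
    refine le_trans ?_ (mul_le_mul_of_nonneg_left hlog (by linarith))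
    rw [← mul_div_assoc, le_div_iff₀ (by linarith)]
    nlinarith [mul_nonneg (sq_nonneg δ) (sub_nonneg.2 h₁)]
  rw [hden, div_le_iff₀ (Real.exp_pos _), ← Real.exp_add]
  refine hnum.trans (Real.exp_le_exp.2 ?_)
  have := mul_le_mul_of_nonneg_right hm hlog₀
  have := mul_le_mul_of_nonneg_right hrate hμ
  linarith

/-- For `k ≥ 2` and `d ≥ 16·log₂ k`, for all sufficiently large `n`,
`E[LCS(X¹,…,X^d)] ≤ (n/k)·(1 + 4·√(ln k / d)) + 1 + n^{d+1}·k^{−2n/k}`. -/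
theorem expected_lcs_upper (k d : ℕ) (hk : 2 ≤ k)
    (hd : 16 * Real.logb 2 k ≤ d) :
    ∀ᶠ n : ℕ in Filter.atTop,
      expLCS k d n ≤
        ((n : ℝ) / k) * (1 + 4 * Real.sqrt (Real.log k / d)) + 1 +
          (n : ℝ) ^ (d + 1) * (k : ℝ) ^ (-(2 * (n : ℝ) / k)) := by
  have hk₀ : (0 : ℝ) < k := by positivity
  have hk₂ : (2 : ℝ) ≤ k := by exact_mod_cast hk
  have hlogk : 0 < Real.log k := Real.log_pos (by linarith)
  have hlog2 : Real.log 2 ≤ 1 := by linarith [Real.log_two_lt_d9]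
  have hlog2₀ : 0 < Real.log 2 := Real.log_pos one_lt_two
  have hd' : 16 * Real.log k ≤ d := by
    refine le_trans ?_ hd
    rw [Real.logb]
    gcongr
    exact le_div_self hlogk.le hlog2₀ hlog2
  have hd₀ : (0 : ℝ) < d := by linarith
  have hdpos : 0 < d := by exact_mod_cast hd₀
  set δ : ℝ := 4 * Real.sqrt (Real.log k / d) with hδ
  have hδsq : δ ^ 2 = 16 * Real.log k / d := by
    rw [hδ, mul_pow, Real.sq_sqrt (by positivity)]
    ring
  have hδ₀ : 0 ≤ δ := by positivity
  have hδ₁ : δ ≤ 1 := by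
    refine (sq_le_one_iff₀ hδ₀).1 ?_
    rw [hδsq]
    exact (div_le_one hd₀).2 hd'
  filter_upwards [Filter.eventually_ge_atTop k] with n hn
  have hn₀ : 0 < n := by omega
  have hμ : (1 : ℝ) ≤ n / k := (one_le_div hk₀).2 (by exact_mod_cast hn)
  set μ : ℝ := n / k with hμdef
  have ht : 0 ≤ (1 + δ) * μ := by positivity
  set l := ⌊(1 + δ) * μ⌋₊ with hl
  have hl₁ : (l : ℝ) ≤ (1 + δ) * μ := Nat.floor_le ht
  have hl₂ : (1 + δ) * μ ≤ ((l + 1 : ℕ) : ℝ) := by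
    push_cast
    exact (Nat.lt_floor_add_one _).le
  have hexp := expLCS_le_add (n := n) (by omega : 0 < k) hdpos l (z := 1 + δ) (by linarith)
  rw [add_sub_cancel_left] at hexp
  have htail : (k : ℝ) ^ (l + 1) * (((1 + δ / k) ^ n / (1 + δ) ^ (l + 1)) ^ d) ≤
      (k : ℝ) ^ (-(2 * (n : ℝ) / k)) := by
    have hpow : (k : ℝ) ^ (l + 1) = Real.exp ((l + 1) * Real.log k) := by
      rw [← Nat.cast_add_one, Real.exp_nat_mul, Real.exp_log hk₀]
    have hrate : d * -(δ ^ 2 / 3 * μ) = -(16 / 3 * μ * Real.log k) := by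
      rw [hδsq]
      field_simp
    calc _ ≤ Real.exp ((l + 1) * Real.log k) * Real.exp (-(δ ^ 2 / 3 * μ)) ^ d := by
          rw [hpow]
          gcongr
          exact one_add_div_pow_div_pow_le hδ₀ hδ₁ hl₂
      _ = Real.exp (((l + 1) - 16 / 3 * μ) * Real.log k) := by
          rw [← Real.exp_nat_mul, ← Real.exp_add, hrate]
          congr 1
          ring
      _ ≤ Real.exp (Real.log k * -(2 * (n : ℝ) / k)) := by
          refine Real.exp_le_exp.2 ?_
          rw [mul_comm (Real.log k), mul_div_assoc, ← hμdef]
          refine mul_le_mul_of_nonneg_right ?_ hlogk.le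
          nlinarith
      _ = _ := (Real.rpow_def_of_pos hk₀ _).symm
  have hnpow : (n : ℝ) ≤ (n : ℝ) ^ (d + 1) :=
    le_self_pow₀ (by exact_mod_cast hn₀) (Nat.succ_ne_zero d)
  have hfinal := mul_le_mul hnpow htail (by positivity) (by positivity)
  linarith
end
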